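/- Let G be a finite group and let H ≤ A ≤ L ≤ G be subgroups. If A is a total perfect code of the pair (G,H), then A is a total perfect code of the pair (L,H). -/

import Mathlib

open scoped Pointwise

/-- A perfect code in a graph: an independent set `C` of vertices such that every
vertex outside of `C` is adjacent to exactly one vertex in `C`. -/
def IsPerfectCode {V : Type*} (Γ : SimpleGraph V) (C : Set V) : Prop :=
  (∀ a ∈ C, ∀ b ∈ C, ¬ Γ.Adj a b) ∧ ∀ v ∉ C, ∃! c, c ∈ C ∧ Γ.Adj v c

/-- A total perfect code in a graph: a set `C` of vertices such that every vertex
of the graph is adjacent to exactly one vertex in `C`. -/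
def IsTotalPerfectCode {V : Type*} (Γ : SimpleGraph V) (C : Set V) : Prop :=
  ∀ v, ∃! c, c ∈ C ∧ Γ.Adj v c

/-- The coset graph `Cos(G,H,U)`: vertices are the left cosets of `H` in `G`, and
`g₁H` is adjacent to `g₂H` iff `g₁⁻¹ * g₂ ∈ U`.  (When `HUH = U`, `H ∩ U = ∅` and
`U⁻¹ = U`, this matches the usual definition.) -/
def cosetGraph {G : Type*} [Group G] (H : Subgroup G) (U : Set G) :
    SimpleGraph (G ⧸ H) :=
  SimpleGraph.fromRel fun x y =>
    ∃ g₁ g₂ : G, QuotientGroup.mk g₁ = x ∧ QuotientGroup.mk g₂ = y ∧ g₁⁻¹ * g₂ ∈ U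

/-- `A` is a perfect code of the pair `(G,H)`: there is `U ⊆ G` with `HUH = U`,
`H ∩ U = ∅`, `U⁻¹ = U` such that `A/H = {aH : a ∈ A}` is a perfect code in the
coset graph `Cos(G,H,U)`. -/
def IsPerfectCodePair {G : Type*} [Group G] (H A : Subgroup G) : Prop :=
  ∃ U : Set G,
    (H : Set G) * U * (H : Set G) = U ∧
    (H : Set G) ∩ U = ∅ ∧
    U⁻¹ = U ∧
    IsPerfectCode (cosetGraph H U) ((QuotientGroup.mk : G → G ⧸ H) '' (A : Set G))

/-- `A` is a total perfect code of the pair `(G,H)`. -/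
def IsTotalPerfectCodePair {G : Type*} [Group G] (H A : Subgroup G) : Prop :=
  ∃ U : Set G,
    (H : Set G) * U * (H : Set G) = U ∧
    (H : Set G) ∩ U = ∅ ∧
    U⁻¹ = U ∧
    IsTotalPerfectCode (cosetGraph H U) ((QuotientGroup.mk : G → G ⧸ H) '' (A : Set G))

/-- A left transversal of `A` in `G`: a set containing exactly one element of each
left coset of `A`. -/
def IsLeftTransversal {G : Type*} [Group G] (X : Set G) (A : Subgroup G) : Prop :=
  ∀ g : G, ∃! x, x ∈ X ∧ g⁻¹ * x ∈ A

/-- A right transversal of `A` in `G`: a set containing exactly one element of each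
right coset of `A`. -/
def IsRightTransversal {G : Type*} [Group G] (Y : Set G) (A : Subgroup G) : Prop :=
  ∀ g : G, ∃! y, y ∈ Y ∧ y * g⁻¹ ∈ A

/-- Adjacency in a coset graph can be tested on arbitrary representatives. -/
theorem cosetGraph_adj_mk {G : Type*} [Group G] {H : Subgroup G} {U : Set G}
    (hU : (H : Set G) * U * (H : Set G) = U) (hHU : (H : Set G) ∩ U = ∅) (hinv : U⁻¹ = U)
    (x y : G) :
    (cosetGraph H U).Adj (QuotientGroup.mk x) (QuotientGroup.mk y) ↔ x⁻¹ * y ∈ U := by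
  have rel_mem : ∀ x y : G, (∃ g₁ g₂ : G, (QuotientGroup.mk g₁ : G ⧸ H) = QuotientGroup.mk x ∧
      (QuotientGroup.mk g₂ : G ⧸ H) = QuotientGroup.mk y ∧ g₁⁻¹ * g₂ ∈ U) → x⁻¹ * y ∈ U := by
    rintro x y ⟨g₁, g₂, h₁, h₂, hg⟩
    rw [← hU]
    have e : x⁻¹ * y = x⁻¹ * g₁ * (g₁⁻¹ * g₂) * (g₂⁻¹ * y) := by group
    rw [e]
    exact Set.mul_mem_mul (Set.mul_mem_mul (QuotientGroup.eq.mp h₁.symm) hg)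
      (QuotientGroup.eq.mp h₂)
  rw [cosetGraph, SimpleGraph.fromRel_adj]
  constructor
  · rintro ⟨-, h | h⟩
    · exact rel_mem x y h
    · rw [← hinv, Set.mem_inv]
      simpa using rel_mem y x h
  · intro h
    refine ⟨fun e => ?_, Or.inl ⟨x, y, rfl, rfl, h⟩⟩
    exact Set.eq_empty_iff_forall_notMem.mp hHU _ ⟨QuotientGroup.eq.mp e, h⟩

/-- `A/H` is a total perfect code in `Cos(G,H,U)` iff each `g⁻¹A` meets `U` in exactly one
left coset of `H`. -/
theorem isTotalPerfectCode_cosetGraph_iff {G : Type*} [Group G] {H A : Subgroup G} {U : Set G}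
    (hU : (H : Set G) * U * (H : Set G) = U) (hHU : (H : Set G) ∩ U = ∅) (hinv : U⁻¹ = U) :
    IsTotalPerfectCode (cosetGraph H U) ((QuotientGroup.mk : G → G ⧸ H) '' (A : Set G)) ↔
      ∀ g : G, ∃ a ∈ A, g⁻¹ * a ∈ U ∧ ∀ b ∈ A, g⁻¹ * b ∈ U → b⁻¹ * a ∈ H := by
  have adj := cosetGraph_adj_mk hU hHU hinv
  constructor
  · intro h g
    obtain ⟨_, ⟨⟨a, ha, rfl⟩, hga⟩, huniq⟩ := h (QuotientGroup.mk g)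
    exact ⟨a, ha, (adj g a).mp hga, fun b hb hgb =>
      QuotientGroup.eq.mp (huniq _ ⟨⟨b, hb, rfl⟩, (adj g b).mpr hgb⟩)⟩
  · intro h v
    obtain ⟨g, rfl⟩ := QuotientGroup.mk_surjective v
    obtain ⟨a, ha, hga, huniq⟩ := h g
    refine ⟨QuotientGroup.mk a, ⟨⟨a, ha, rfl⟩, (adj g a).mpr hga⟩, ?_⟩
    rintro _ ⟨⟨b, hb, rfl⟩, hgb⟩
    exact QuotientGroup.eq.mpr (huniq b hb ((adj g b).mp hgb))

/-- if `H ≤ A ≤ L ≤ G` and `A` is a total perfect code of `(G,H)`,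
then `A` is a total perfect code of `(L,H)`. -/
theorem totalPerfectCodePair_of_le
    {G : Type*} [Group G] [Finite G] (H A L : Subgroup G)
    (hHA : H ≤ A) (hAL : A ≤ L) (h : IsTotalPerfectCodePair H A) :
    IsTotalPerfectCodePair (H.subgroupOf L) (A.subgroupOf L) := by
  obtain ⟨U, hU, hHU, hinv, hcode⟩ := h
  have hU' : (H.subgroupOf L : Set L) * (Subtype.val ⁻¹' U) * (H.subgroupOf L : Set L) =
      Subtype.val ⁻¹' U := by
    apply Set.Subset.antisymm
    · rintro _ ⟨_, ⟨x, hx, u, hu, rfl⟩, y, hy, rfl⟩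
      rw [Set.mem_preimage, ← hU]
      exact Set.mul_mem_mul (Set.mul_mem_mul hx hu) hy
    · intro u hu
      exact ⟨u, ⟨1, one_mem _, u, hu, one_mul u⟩, 1, one_mem _, mul_one u⟩
  have hHU' : (H.subgroupOf L : Set L) ∩ Subtype.val ⁻¹' U = ∅ :=
    Set.eq_empty_of_forall_notMem fun x hx =>
      Set.eq_empty_iff_forall_notMem.mp hHU (x : G) hx
  have hinv' : (Subtype.val ⁻¹' U : Set L)⁻¹ = Subtype.val ⁻¹' U := by
    ext x
    change (x : G) ∈ U⁻¹ ↔ (x : G) ∈ U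
    rw [hinv]
  refine ⟨Subtype.val ⁻¹' U, hU', hHU', hinv',
    (isTotalPerfectCode_cosetGraph_iff hU' hHU' hinv').mpr fun g => ?_⟩
  obtain ⟨a, ha, hga, huniq⟩ := (isTotalPerfectCode_cosetGraph_iff hU hHU hinv).mp hcode g
  exact ⟨⟨a, hAL ha⟩, ha, hga, fun b hb hgb => huniq b hb hgb⟩
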